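/- arXiv:math/0605453 — 3 statements merged into one kernel-verified Lean document; each statement's English description precedes it below -/
import Mathlib

section
/- (Proposition 1.2, first part.) Let γ ≥ 0 and α > 0 be such that ψ_γ(αk) ≠ 0 for every integer k ≥ 1. Then the power series I_{α,ψ_γ}(z) = Σ_{n≥0} a_n(ψ_γ;α) z^n has infinite radius of convergence; in particular I_{α,ψ_γ} defines an entire function of z ∈ ℂ. -/
open MeasureTheory Real Set Filter Topology

/-- The Laplace exponent of a spectrally negative infinitely divisible random variable. -/
noncomputable def psi (σ b : ℝ) (ν : Measure ℝ) (u : ℝ) : ℝ :=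
  b * u + σ / 2 * u ^ 2 +
    ∫ r in Ioi (0 : ℝ), (Real.exp (-u * r) - 1 + (if r ≤ 1 then u * r else 0)) ∂ν

/-- The coefficients `a_n(ψ;α) = (∏_{k=1}^n ψ(αk))⁻¹`, with `a_0 = 1`. -/
noncomputable def coeffA (ψ : ℝ → ℝ) (α : ℝ) (n : ℕ) : ℝ :=
  (∏ k ∈ Finset.range n, ψ (α * (k + 1)))⁻¹

theorem integrableOn_min_one_sq {ν : Measure ℝ}
    (hν : ∫⁻ r in Ioi (0 : ℝ), ENNReal.ofReal (min 1 (r ^ 2)) ∂ν < ⊤) :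
    IntegrableOn (fun r : ℝ => min 1 (r ^ 2)) (Ioi 0) ν := by
  refine ⟨by fun_prop, ?_⟩
  rw [hasFiniteIntegral_iff_ofReal (Eventually.of_forall fun r => by positivity)]
  exact hν

theorem measure_Ioi_lt_top_of_lintegral_min_one_sq {ν : Measure ℝ}
    (hν : ∫⁻ r in Ioi (0 : ℝ), ENNReal.ofReal (min 1 (r ^ 2)) ∂ν < ⊤) {ε : ℝ}
    (hε : 0 < ε) (hε1 : ε ≤ 1) : ν (Ioi ε) < ⊤ := by
  have hi : IntegrableOn (fun r : ℝ => min 1 (r ^ 2)) (Ioi ε) ν :=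
    (integrableOn_min_one_sq hν).mono_set (Ioi_subset_Ioi hε.le)
  have hc : IntegrableOn (fun _ : ℝ => ε ^ 2) (Ioi ε) ν := by
    refine Integrable.mono' hi (by fun_prop) ?_
    filter_upwards [ae_restrict_mem measurableSet_Ioi] with r hr
    have hr : ε < r := hr
    rw [norm_of_nonneg (by positivity), le_min_iff]
    exact ⟨by nlinarith, by nlinarith⟩
  rw [integrableOn_const_iff] at hc
  exact hc.resolve_left (by simp [hε.ne'])

theorem integrableOn_id_Ioc {ν : Measure ℝ}
    (hν : ∫⁻ r in Ioi (0 : ℝ), ENNReal.ofReal (min 1 (r ^ 2)) ∂ν < ⊤) {ε : ℝ}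
    (hε : 0 < ε) (hε1 : ε ≤ 1) : IntegrableOn (fun r : ℝ => r) (Ioc ε 1) ν := by
  refine Measure.integrableOn_of_bounded (M := 1)
    ((measure_mono Ioc_subset_Ioi_self).trans_lt
      (measure_Ioi_lt_top_of_lintegral_min_one_sq hν hε hε1)).ne (by fun_prop) ?_
  filter_upwards [ae_restrict_mem measurableSet_Ioc] with r hr
  rw [norm_of_nonneg (hε.trans hr.1).le]
  exact hr.2

theorem integrableOn_psi_integrand {ν : Measure ℝ}
    (hν : ∫⁻ r in Ioi (0 : ℝ), ENNReal.ofReal (min 1 (r ^ 2)) ∂ν < ⊤) {u : ℝ} (hu : 0 ≤ u) :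
    IntegrableOn (fun r : ℝ => Real.exp (-u * r) - 1 + (if r ≤ 1 then u * r else 0))
      (Ioi 0) ν := by
  refine Integrable.mono' ((integrableOn_min_one_sq hν).const_mul (1 + u ^ 2)) ?_ ?_
  · have : Measurable fun r : ℝ => if r ≤ 1 then u * r else 0 :=
      Measurable.ite measurableSet_Iic (by fun_prop) (by fun_prop)
    exact (Measurable.add (by fun_prop) this).aestronglyMeasurable
  · filter_upwards [ae_restrict_mem measurableSet_Ioi] with r hr
    have hr : 0 < r := hr
    have hur : 0 ≤ u * r := by positivity
    have h1 := Real.add_one_le_exp (-u * r)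
    have h2 : Real.exp (-u * r) ≤ 1 := Real.exp_le_one_iff.2 (by linarith)
    have h3 := Real.exp_pos (-u * r)
    rw [Real.norm_eq_abs, abs_le]
    split_ifs with h
    · have h4 : Real.exp (-u * r) ≤ 1 - u * r + (u * r) ^ 2 := by
        by_cases h5 : u * r ≤ 1
        · have := abs_le.1 (Real.abs_exp_sub_one_sub_id_le (x := -u * r)
            (by rw [abs_le]; constructor <;> linarith))
          nlinarith [this.2]
        · nlinarith
      rw [min_eq_right (by nlinarith)]
      constructor <;> nlinarith [sq_nonneg (u * r), sq_nonneg r]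
    · rw [min_eq_left (by nlinarith)]
      constructor <;> nlinarith [sq_nonneg u]

theorem le_psi {σ b : ℝ} {ν : Measure ℝ}
    (hν : ∫⁻ r in Ioi (0 : ℝ), ENNReal.ofReal (min 1 (r ^ 2)) ∂ν < ⊤) {ε u : ℝ}
    (hε : 0 < ε) (hε1 : ε ≤ 1) (hu : 0 ≤ u) :
    (b + ∫ r in Ioc ε 1, r ∂ν) * u + σ / 2 * u ^ 2 - ν.real (Ioi ε) ≤ psi σ b ν u := by
  have hfin := measure_Ioi_lt_top_of_lintegral_min_one_sq hν hε hε1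
  have hI : IntegrableOn (fun r : ℝ => u * r) (Ioc ε 1) ν :=
    (integrableOn_id_Ioc hν hε hε1).const_mul u
  have hI1 : IntegrableOn (fun _ : ℝ => (1 : ℝ)) (Ioi ε) ν := integrableOn_const hfin.ne
  have hI' : IntegrableOn ((Ioc ε 1).indicator fun r : ℝ => u * r) (Ioi 0) ν :=
    (hI.integrable_indicator measurableSet_Ioc).integrableOn
  have hI1' : IntegrableOn ((Ioi ε).indicator fun _ : ℝ => (1 : ℝ)) (Ioi 0) ν :=
    (hI1.integrable_indicator measurableSet_Ioi).integrableOn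
  have key : ∫ r in Ioi (0 : ℝ), ((Ioc ε 1).indicator (fun r : ℝ => u * r) r -
        (Ioi ε).indicator (fun _ : ℝ => (1 : ℝ)) r) ∂ν ≤
      ∫ r in Ioi (0 : ℝ), (Real.exp (-u * r) - 1 + (if r ≤ 1 then u * r else 0)) ∂ν := by
    refine setIntegral_mono_on (hI'.sub hI1') (integrableOn_psi_integrand hν hu)
      measurableSet_Ioi fun r _ => ?_
    have h1 := Real.add_one_le_exp (-u * r)
    have h3 := Real.exp_pos (-u * r)
    simp only [indicator_apply, mem_Ioc, mem_Ioi]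
    split_ifs <;> grind
  rw [integral_sub hI' hI1', setIntegral_indicator measurableSet_Ioc,
    setIntegral_indicator measurableSet_Ioi,
    inter_eq_self_of_subset_right (Ioc_subset_Ioi_self.trans (Ioi_subset_Ioi hε.le)),
    inter_eq_self_of_subset_right (Ioi_subset_Ioi hε.le), integral_const_mul,
    setIntegral_const] at key
  simp only [smul_eq_mul, mul_one] at key
  unfold psi
  linarith

theorem exists_lt_setIntegral_Ioc_of_not_integrableOn {ν : Measure ℝ}
    (hν : ∫⁻ r in Ioi (0 : ℝ), ENNReal.ofReal (min 1 (r ^ 2)) ∂ν < ⊤)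
    (h : ¬ IntegrableOn (fun r : ℝ => r) (Ioc 0 1) ν) (C : ℝ) :
    ∃ ε : ℝ, 0 < ε ∧ ε ≤ 1 ∧ C < ∫ r in Ioc ε 1, r ∂ν := by
  by_contra! hC
  let a : ℕ → ℝ := fun n => 1 / ((n : ℝ) + 1)
  have ha0 (n : ℕ) : 0 < a n := by positivity
  have ha1 (n : ℕ) : a n ≤ 1 := by
    simp only [a]
    rw [div_le_one (by positivity)]
    linarith [(Nat.cast_nonneg n : (0 : ℝ) ≤ n)]
  have hlim : Tendsto a atTop (𝓝 0) := tendsto_one_div_add_atTop_nhds_zero_nat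
  have hcover : AECover (ν.restrict (Ioc 0 1)) atTop fun n => Ioc (a n) 1 := by
    refine ⟨?_, fun n => measurableSet_Ioc⟩
    filter_upwards [ae_restrict_mem measurableSet_Ioc] with r hr
    filter_upwards [hlim.eventually_lt_const hr.1] with n hn
    exact ⟨hn, hr.2⟩
  have hsub (n : ℕ) : Ioc (a n) 1 ⊆ Ioc 0 1 := Ioc_subset_Ioc_left (ha0 n).le
  refine h (hcover.integrable_of_integral_norm_bounded C (fun n => ?_)
    (Eventually.of_forall fun n => ?_))
  · exact (integrableOn_id_Ioc hν (ha0 n) (ha1 n)).restrict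
  · rw [Measure.restrict_restrict measurableSet_Ioc, inter_eq_self_of_subset_left (hsub n),
      setIntegral_congr_fun (g := fun r => r) measurableSet_Ioc fun r hr =>
        norm_of_nonneg ((ha0 n).trans hr.1).le]
    exact hC _ (ha0 n) (ha1 n)

theorem tendsto_psi_atTop {σ b : ℝ} {ν : Measure ℝ} (hσ : 0 ≤ σ)
    (hν : ∫⁻ r in Ioi (0 : ℝ), ENNReal.ofReal (min 1 (r ^ 2)) ∂ν < ⊤)
    (hns : 0 < σ ∨ ¬ IntegrableOn (fun r => r) (Ioc 0 1) ν ∨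
      0 < b - ∫ r in Ioc (0 : ℝ) 1, r ∂ν) :
    Tendsto (psi σ b ν) atTop atTop := by
  suffices H : ∃ ε : ℝ, 0 < ε ∧ ε ≤ 1 ∧ (0 < σ ∨ 0 < b + ∫ r in Ioc ε 1, r ∂ν) by
    obtain ⟨ε, hε, hε1, h⟩ := H
    have hlow : ∀ᶠ u in atTop, (b + ∫ r in Ioc ε 1, r ∂ν) * u + σ / 2 * u ^ 2 -
        ν.real (Ioi ε) ≤ psi σ b ν u := by
      filter_upwards [eventually_ge_atTop 0] with u hu using le_psi hν hε hε1 hu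
    refine tendsto_atTop_mono' _ hlow ?_
    generalize b + ∫ r in Ioc ε 1, r ∂ν = c at h
    rcases hσ.lt_or_eq with hσ | rfl
    · have h1 : Tendsto (fun u : ℝ => c + σ / 2 * u) atTop atTop :=
        tendsto_atTop_add_const_left _ _ (tendsto_id.const_mul_atTop (by positivity))
      refine (tendsto_atTop_add_const_right _ (-ν.real (Ioi ε))
        (tendsto_id.atTop_mul_atTop₀ h1)).congr fun u => ?_
      simp only [id]
      ring
    · have hc : 0 < c := h.resolve_left (lt_irrefl _)
      refine (tendsto_atTop_add_const_right _ (-ν.real (Ioi ε))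
        (tendsto_id.const_mul_atTop hc)).congr fun u => ?_
      simp only [id]
      ring
  rcases hns with h | h | h
  · exact ⟨1, one_pos, le_rfl, Or.inl h⟩
  · obtain ⟨ε, h0, h1, h2⟩ := exists_lt_setIntegral_Ioc_of_not_integrableOn hν h (-b)
    exact ⟨ε, h0, h1, Or.inr (by linarith)⟩
  · have h0 : 0 ≤ ∫ r in Ioc (0 : ℝ) 1, r ∂ν :=
      setIntegral_nonneg measurableSet_Ioc fun r hr => hr.1.le
    exact ⟨1, one_pos, le_rfl, Or.inr (by simp; linarith)⟩

theorem coeffA_succ (ψ : ℝ → ℝ) (α : ℝ) (n : ℕ) :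
    coeffA ψ α (n + 1) = coeffA ψ α n * (ψ (α * (n + 1)))⁻¹ := by
  simp [coeffA, Finset.prod_range_succ, mul_comm]

theorem coeffA_radius_eq_top {ψ : ℝ → ℝ} {α : ℝ} (hα : 0 < α)
    (hne : ∀ n : ℕ, ψ (α * (n + 1)) ≠ 0) (hψ : Tendsto ψ atTop atTop) :
    (FormalMultilinearSeries.ofScalars ℂ fun n => (coeffA ψ α n : ℂ)).radius = ⊤ := by
  have h0 (n : ℕ) : coeffA ψ α n ≠ 0 :=
    inv_ne_zero (Finset.prod_ne_zero_iff.2 fun k _ => hne k)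
  refine FormalMultilinearSeries.ofScalars_radius_eq_top_of_tendsto ℂ _
    (Eventually.of_forall fun n => by exact_mod_cast h0 n) ?_
  have harg : Tendsto (fun n : ℕ => α * ((n : ℝ) + 1)) atTop atTop :=
    (tendsto_atTop_add_const_right _ 1 tendsto_natCast_atTop_atTop).const_mul_atTop hα
  have hlim := (tendsto_inv_atTop_zero.comp (hψ.comp harg)).norm
  rw [norm_zero] at hlim
  refine hlim.congr fun n => ?_
  rw [Nat.succ_eq_add_one, coeffA_succ, Complex.ofReal_mul, norm_mul, Complex.norm_real,
    Complex.norm_real, mul_div_cancel_left₀ _ (norm_ne_zero_iff.2 (h0 n))]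
  rfl

/-- Proposition 1.2, first part: the power series `I_{α,ψ_γ}(z) = Σ a_n(ψ_γ;α) z^n` converges
for every complex `z` and defines an entire function. -/
theorem Ifun_entire (σ b : ℝ) (ν : Measure ℝ)
    (hσ : 0 ≤ σ)
    (hν : ∫⁻ r in Ioi (0 : ℝ), ENNReal.ofReal (min 1 (r ^ 2)) ∂ν < ⊤)
    (hnd : 0 < σ ∨ ν (Ioi 0) ≠ 0 ∨ b ≠ 0)
    (hns : 0 < σ ∨ ¬ IntegrableOn (fun r => r) (Ioc 0 1) ν ∨
      0 < b - ∫ r in Ioc (0 : ℝ) 1, r ∂ν)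
    (γ α : ℝ) (hγ : 0 ≤ γ) (hα : 0 < α)
    (hne : ∀ k : ℕ, 1 ≤ k → psi σ b ν (α * k + γ) - psi σ b ν γ ≠ 0) :
    (∀ z : ℂ,
      Summable fun n : ℕ =>
        (coeffA (fun u => psi σ b ν (u + γ) - psi σ b ν γ) α n : ℂ) * z ^ n) ∧
    AnalyticOnNhd ℂ
      (fun z : ℂ => ∑' n : ℕ,
        (coeffA (fun u => psi σ b ν (u + γ) - psi σ b ν γ) α n : ℂ) * z ^ n)
      Set.univ := by
  have htend : Tendsto (fun u => psi σ b ν (u + γ) - psi σ b ν γ) atTop atTop :=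
    tendsto_atTop_add_const_right _ _ ((tendsto_psi_atTop hσ hν hns).comp
      (tendsto_atTop_add_const_right _ γ tendsto_id))
  have hrad := coeffA_radius_eq_top hα
    (fun n => by simpa using hne (n + 1) n.succ_pos) htend
  set c : ℕ → ℂ := fun n =>
    (coeffA (fun u => psi σ b ν (u + γ) - psi σ b ν γ) α n : ℂ)
  have hball := (FormalMultilinearSeries.ofScalars ℂ c).hasFPowerSeriesOnBall
    (by rw [hrad]; exact ENNReal.zero_lt_top)
  rw [hrad] at hball
  constructor
  · intro z
    have := (hball.hasSum (y := z) (by simp)).summable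
    rwa [FormalMultilinearSeries.ofScalars_apply_eq'] at this
  · have h := hball.analyticOnNhd
    rw [Metric.eball_top] at h
    exact (FormalMultilinearSeries.ofScalarsSum_eq_tsum (E := ℂ) c) ▸ h
end

section
/- (Eigenfunction characterization, analytic core of Theorem 2.1.) Let γ ≥ 0, α > 0 and assume ψ_γ(αk) > 0 for every integer k ≥ 1. For q ≥ 0 define f_q(x) = I_{α,ψ_γ}(q·x^α) for x > 0. Then f_q is infinitely differentiable on (0,∞), the integral in L^{(γ)} f_q(x) converges absolutely for every x > 0, and f_q solves the integro-differential equation L^{(γ)} f_q(x) = q·f_q(x) for all x > 0. -/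
open MeasureTheory Real Set Filter Topology

/-- The power series `I_{α,ψ}(x) = Σ_{n≥0} a_n(ψ;α) x^n`. -/
noncomputable def Iser (ψ : ℝ → ℝ) (α : ℝ) (x : ℝ) : ℝ :=
  ∑' n : ℕ, coeffA ψ α n * x ^ n

/-- The Lamperti integro-differential operator `L^{(γ)}` associated to `ψ_γ` and index `α`. -/
noncomputable def Lop (σ b γ α : ℝ) (ν : Measure ℝ) (f : ℝ → ℝ) (x : ℝ) : ℝ :=
  x ^ (-α) * (σ / 2 * x ^ 2 * deriv (deriv f) x + (σ * γ + b + σ / 2) * x * deriv f x +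
    ∫ r in Ioi (0 : ℝ),
      ((f (Real.exp (-r) * x) - f x) * Real.exp (-γ * r)
        + x * deriv f x * (if r ≤ 1 then r else 0)) ∂ν)

/-- Coefficient sequences of everywhere absolutely convergent power series. -/
def EntireCoeff (w : ℕ → ℝ) : Prop :=
  ∀ s : ℝ, 0 ≤ s → Summable fun n => |w n| * s ^ n

/-- The generalized power series `Σ_n w_n x^{αn}`. -/
noncomputable def powSeries (α : ℝ) (w : ℕ → ℝ) (x : ℝ) : ℝ :=
  ∑' n : ℕ, w n * (x ^ α) ^ n

theorem EntireCoeff.summable {w : ℕ → ℝ} (hw : EntireCoeff w) {s : ℝ} (hs : 0 ≤ s) :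
    Summable fun n => w n * s ^ n := by
  refine Summable.of_norm ((hw s hs).congr fun n => ?_)
  rw [Real.norm_eq_abs, abs_mul, abs_of_nonneg (pow_nonneg hs n)]

theorem EntireCoeff.mul_nat {w : ℕ → ℝ} (hw : EntireCoeff w) (c : ℝ) :
    EntireCoeff fun n => c * n * w n := by
  intro s hs
  refine Summable.of_nonneg_of_le (fun n => by positivity) (fun n => ?_)
    ((hw (2 * s) (by positivity)).mul_left |c|)
  have h2 : (n : ℝ) ≤ 2 ^ n := by exact_mod_cast n.lt_two_pow_self.le
  rw [abs_mul, abs_mul, Nat.abs_cast, mul_pow]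
  calc |c| * n * |w n| * s ^ n ≤ |c| * 2 ^ n * |w n| * s ^ n := by gcongr
    _ = |c| * (|w n| * (2 ^ n * s ^ n)) := by ring

theorem hasDerivAt_rpow_pow {α y : ℝ} (hy : 0 < y) (n : ℕ) :
    HasDerivAt (fun z : ℝ => (z ^ α) ^ n) (α * n * (y ^ α) ^ n / y) y := by
  refine ((Real.hasDerivAt_rpow_const (p := α) (Or.inl hy.ne')).fun_pow n).congr_deriv ?_
  rcases n with _ | n
  · simp
  · rw [Real.rpow_sub_one hy.ne', Nat.add_sub_cancel]
    ring

theorem hasDerivAt_powSeries {α : ℝ} (hα : 0 < α) {w : ℕ → ℝ} (hw : EntireCoeff w)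
    {x : ℝ} (hx : 0 < x) :
    HasDerivAt (powSeries α w) (powSeries α (fun n => α * n * w n) x / x) x := by
  have hbound : Summable fun n => |α * n * w n| * ((2 * x) ^ α) ^ n * (2 / x) :=
    (hw.mul_nat α _ (by positivity)).mul_right _
  have hmem : x ∈ Ioo (x / 2) (2 * x) := ⟨by linarith, by linarith⟩
  have h := hasDerivAt_tsum_of_isPreconnected (g := fun n z => w n * (z ^ α) ^ n)
    (g' := fun n z => w n * (α * n * (z ^ α) ^ n / z)) (t := Ioo (x / 2) (2 * x))
    (y₀ := x) (y := x) hbound isOpen_Ioo isPreconnected_Ioo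
    (fun n y hy => (hasDerivAt_rpow_pow (by linarith [hy.1]) n).const_mul (w n))
    (fun n y hy => ?_) hmem (hw.summable (by positivity)) hmem
  · refine h.congr_deriv ?_
    rw [powSeries, ← tsum_div_const]
    exact tsum_congr fun n => by ring
  · have hy0 : 0 < y := by linarith [hy.1]
    have h1 : y ^ α ≤ (2 * x) ^ α := Real.rpow_le_rpow hy0.le hy.2.le hα.le
    have h2 : 1 / y ≤ 2 / x := by
      rw [div_le_div_iff₀ hy0 hx]; linarith [hy.1]
    have h3 : ‖w n * (α * n * (y ^ α) ^ n / y)‖ = |α * n * w n| * (y ^ α) ^ n * (1 / y) := by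
      rw [Real.norm_eq_abs,
        show w n * (α * n * (y ^ α) ^ n / y) = (α * n * w n) * ((y ^ α) ^ n * (1 / y)) by ring,
        abs_mul, abs_of_nonneg (show 0 ≤ (y ^ α) ^ n * (1 / y) by positivity), ← mul_assoc]
    rw [h3]
    gcongr

theorem mul_deriv_powSeries {α : ℝ} (hα : 0 < α) {w : ℕ → ℝ} (hw : EntireCoeff w)
    {x : ℝ} (hx : 0 < x) :
    x * deriv (powSeries α w) x = powSeries α (fun n => α * n * w n) x := by
  rw [(hasDerivAt_powSeries hα hw hx).deriv, mul_div_cancel₀ _ hx.ne']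

theorem contDiffOn_powSeries {α : ℝ} (hα : 0 < α) {w : ℕ → ℝ} (hw : EntireCoeff w) :
    ContDiffOn ℝ (⊤ : ℕ∞) (powSeries α w) (Ioi 0) := by
  rw [contDiffOn_infty]
  intro k
  induction k generalizing w with
  | zero =>
    exact contDiffOn_zero.2 fun x hx =>
      (hasDerivAt_powSeries hα hw hx).continuousAt.continuousWithinAt
  | succ k ih =>
    rw [Nat.cast_succ, contDiffOn_succ_iff_deriv_of_isOpen isOpen_Ioi]
    refine ⟨fun x hx =>
      (hasDerivAt_powSeries hα hw hx).differentiableAt.differentiableWithinAt,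
      by simp, ?_⟩
    refine ((ih (hw.mul_nat α)).div contDiffOn_id fun x hx => (mem_Ioi.1 hx).ne').congr
      fun x hx => (hasDerivAt_powSeries hα hw hx).deriv

/-- The integrand `(e^{-βr} - 1) e^{-γr} + β r 𝟙_{r ≤ 1}` of the exponent `ψ_γ` at `β`. -/
noncomputable def levyKernel (γ β r : ℝ) : ℝ :=
  (Real.exp (-β * r) - 1) * Real.exp (-γ * r) + β * (if r ≤ 1 then r else 0)

theorem measurable_levyKernel (γ β : ℝ) : Measurable (levyKernel γ β) := by
  unfold levyKernel
  refine Measurable.add (by fun_prop) (Measurable.const_mul ?_ _)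
  exact Measurable.ite measurableSet_Iic measurable_id measurable_const

theorem abs_levyKernel_le {γ β r : ℝ} (hγ : 0 ≤ γ) (hβ : 0 ≤ β) (hr : 0 < r) :
    |levyKernel γ β r| ≤ (1 + β ^ 2 + β * γ) * min 1 (r ^ 2) := by
  have hβr : 0 ≤ β * r := by positivity
  have hγr : 0 ≤ γ * r := by positivity
  have e1 : Real.exp (-β * r) ≤ 1 := Real.exp_le_one_iff.2 (by linarith)
  have e2 : Real.exp (-γ * r) ≤ 1 := Real.exp_le_one_iff.2 (by linarith)
  have e3 := Real.exp_pos (-β * r)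
  have e4 := Real.exp_pos (-γ * r)
  have e5 : 1 - β * r ≤ Real.exp (-β * r) := by linarith [Real.add_one_le_exp (-β * r)]
  have e6 : 1 - γ * r ≤ Real.exp (-γ * r) := by linarith [Real.add_one_le_exp (-γ * r)]
  unfold levyKernel
  by_cases h1 : r ≤ 1
  · have hmin : min 1 (r ^ 2) = r ^ 2 := min_eq_right (by nlinarith)
    have e7 : Real.exp (-β * r) - 1 + β * r ≤ (β * r) ^ 2 := by
      have h : Real.exp (-β * r) * (1 + β * r) ≤ 1 := by
        calc Real.exp (-β * r) * (1 + β * r) ≤ Real.exp (-β * r) * Real.exp (β * r) := by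
              gcongr; linarith [Real.add_one_le_exp (β * r)]
          _ = 1 := by rw [← Real.exp_add]; simp
      have h' : 1 ≤ (1 - β * r + (β * r) ^ 2) * (1 + β * r) := by nlinarith [pow_nonneg hβr 3]
      nlinarith
    rw [if_pos h1, hmin, show (Real.exp (-β * r) - 1) * Real.exp (-γ * r) + β * r
      = (Real.exp (-β * r) - 1 + β * r) * Real.exp (-γ * r)
        + β * r * (1 - Real.exp (-γ * r)) by ring]
    have h3 : 0 ≤ (Real.exp (-β * r) - 1 + β * r) * Real.exp (-γ * r) :=
      mul_nonneg (by linarith) e4.le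
    have h4 : 0 ≤ β * r * (1 - Real.exp (-γ * r)) := mul_nonneg hβr (by linarith)
    rw [abs_of_nonneg (add_nonneg h3 h4)]
    have h5 : (Real.exp (-β * r) - 1 + β * r) * Real.exp (-γ * r) ≤ (β * r) ^ 2 * 1 :=
      mul_le_mul e7 e2 e4.le (by positivity)
    have h6 : β * r * (1 - Real.exp (-γ * r)) ≤ β * r * (γ * r) := by gcongr; linarith
    nlinarith [sq_nonneg r]
  · have hmin : min 1 (r ^ 2) = 1 := min_eq_left (by nlinarith)
    rw [if_neg h1, hmin, mul_zero, add_zero, abs_mul, abs_of_nonpos (by linarith),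
      abs_of_pos e4]
    have : -(Real.exp (-β * r) - 1) * Real.exp (-γ * r) ≤ 1 * 1 :=
      mul_le_mul (by linarith) e2 e4.le zero_le_one
    nlinarith [mul_nonneg hβ hγ, sq_nonneg β]

theorem mul_levyKernel_le {γ β r : ℝ} (k : ℕ) :
    k * levyKernel γ β r ≤ levyKernel γ (β * k) r := by
  have h := one_add_mul_le_pow (a := Real.exp (-β * r) - 1)
    (by linarith [Real.exp_pos (-β * r)]) k
  rw [add_sub_cancel, ← Real.exp_nat_mul] at h
  have h' := mul_le_mul_of_nonneg_right h (Real.exp_pos (-γ * r)).le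
  unfold levyKernel
  rw [show -(β * k) * r = k * (-β * r) by ring]
  linarith

theorem integrableOn_levyKernel {ν : Measure ℝ}
    (hν : IntegrableOn (fun r : ℝ => min 1 (r ^ 2)) (Ioi 0) ν)
    {γ β : ℝ} (hγ : 0 ≤ γ) (hβ : 0 ≤ β) : IntegrableOn (levyKernel γ β) (Ioi 0) ν := by
  refine (hν.const_mul (1 + β ^ 2 + β * γ)).mono'
    (measurable_levyKernel γ β).aestronglyMeasurable ?_
  filter_upwards [ae_restrict_mem measurableSet_Ioi] with r hr
  exact abs_levyKernel_le hγ hβ hr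

theorem psi_eq {σ b : ℝ} {ν : Measure ℝ} (u : ℝ) :
    psi σ b ν u = b * u + σ / 2 * u ^ 2 + ∫ r in Ioi (0 : ℝ), levyKernel 0 u r ∂ν := by
  simp only [psi, levyKernel, neg_zero, zero_mul, Real.exp_zero, mul_one, mul_ite, mul_zero]

theorem psi_add_sub {σ b : ℝ} {ν : Measure ℝ}
    (hν : IntegrableOn (fun r : ℝ => min 1 (r ^ 2)) (Ioi 0) ν)
    {γ β : ℝ} (hγ : 0 ≤ γ) (hβ : 0 ≤ β) :
    psi σ b ν (β + γ) - psi σ b ν γ =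
      b * β + σ / 2 * (β ^ 2 + 2 * β * γ) + ∫ r in Ioi (0 : ℝ), levyKernel γ β r ∂ν := by
  have h : ∫ r in Ioi (0 : ℝ), levyKernel γ β r ∂ν =
      (∫ r in Ioi (0 : ℝ), levyKernel 0 (β + γ) r ∂ν)
        - ∫ r in Ioi (0 : ℝ), levyKernel 0 γ r ∂ν := by
    rw [← integral_sub (integrableOn_levyKernel hν le_rfl (by positivity))
      (integrableOn_levyKernel hν le_rfl hγ)]
    refine integral_congr_ae (Eventually.of_forall fun r => ?_)
    simp only [levyKernel, neg_zero, zero_mul, Real.exp_zero, mul_one]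
    rw [show -(β + γ) * r = -β * r + -γ * r by ring, Real.exp_add]
    ring
  rw [h, psi_eq, psi_eq]
  ring

theorem mul_psi_le {σ b : ℝ} {ν : Measure ℝ} (hσ : 0 ≤ σ)
    (hν : IntegrableOn (fun r : ℝ => min 1 (r ^ 2)) (Ioi 0) ν)
    {γ β : ℝ} (hγ : 0 ≤ γ) (hβ : 0 ≤ β) (k : ℕ) :
    k * (psi σ b ν (β + γ) - psi σ b ν γ) ≤ psi σ b ν (β * k + γ) - psi σ b ν γ := by
  rw [psi_add_sub hν hγ hβ, psi_add_sub hν hγ (by positivity)]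
  have h : k * ∫ r in Ioi (0 : ℝ), levyKernel γ β r ∂ν ≤
      ∫ r in Ioi (0 : ℝ), levyKernel γ (β * k) r ∂ν := by
    rw [← integral_const_mul]
    exact integral_mono ((integrableOn_levyKernel hν hγ hβ).const_mul _)
      (integrableOn_levyKernel hν hγ (by positivity)) fun r => mul_levyKernel_le k
  have hk : (k : ℝ) ≤ (k : ℝ) ^ 2 := by exact_mod_cast Nat.le_self_pow two_ne_zero k
  have : k * (σ / 2 * β ^ 2) ≤ k ^ 2 * (σ / 2 * β ^ 2) := by gcongr
  linarith

theorem entireCoeff_coeffA {ψ : ℝ → ℝ} {α c : ℝ} (hc : 0 < c)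
    (hψ : ∀ k : ℕ, (k + 1) * c ≤ ψ (α * (k + 1))) (q : ℝ) :
    EntireCoeff fun n => coeffA ψ α n * q ^ n := by
  intro s hs
  refine Summable.of_nonneg_of_le (fun n => by positivity) (fun n => ?_)
    (Real.summable_pow_div_factorial (|q| * s / c))
  have hprod : (n.factorial : ℝ) * c ^ n ≤ ∏ k ∈ Finset.range n, ψ (α * (k + 1)) := by
    calc (n.factorial : ℝ) * c ^ n = ∏ k ∈ Finset.range n, ((k + 1 : ℝ) * c) := by
          rw [Finset.prod_mul_distrib, ← Finset.prod_range_add_one_eq_factorial]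
          push_cast; rw [Finset.prod_const, Finset.card_range]
      _ ≤ _ := Finset.prod_le_prod (fun k _ => by positivity) fun k _ => hψ k
  have hpos : (0 : ℝ) < n.factorial * c ^ n := by positivity
  have hinv : coeffA ψ α n ≤ (n.factorial * c ^ n)⁻¹ := inv_anti₀ hpos hprod
  have h0 : 0 ≤ coeffA ψ α n := inv_nonneg.2 (hpos.le.trans hprod)
  rw [abs_mul, abs_of_nonneg h0, abs_pow]
  calc coeffA ψ α n * |q| ^ n * s ^ n ≤ (n.factorial * c ^ n)⁻¹ * |q| ^ n * s ^ n := by gcongr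
    _ = (|q| * s / c) ^ n / n.factorial := by rw [div_pow, mul_pow]; field_simp

theorem coeffA_succ_mul {ψ : ℝ → ℝ} {α : ℝ} {n : ℕ} (h : ψ (α * (n + 1)) ≠ 0) :
    coeffA ψ α (n + 1) * ψ (α * (n + 1)) = coeffA ψ α n := by
  rw [coeffA, coeffA, Finset.prod_range_succ, mul_inv, mul_assoc, inv_mul_cancel₀ h, mul_one]

theorem hasSum_levyKernel {α γ : ℝ} {w : ℕ → ℝ} (hw : EntireCoeff w)
    {x : ℝ} (hx : 0 < x) (r : ℝ) :
    HasSum (fun n => w n * (x ^ α) ^ n * levyKernel γ (α * n) r)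
      ((powSeries α w (Real.exp (-r) * x) - powSeries α w x) * Real.exp (-γ * r)
        + powSeries α (fun n => α * n * w n) x * (if r ≤ 1 then r else 0)) := by
  have h1 := (hw.summable (s := (Real.exp (-r) * x) ^ α) (by positivity)).hasSum
  have h2 := (hw.summable (s := x ^ α) (by positivity)).hasSum
  have h3 := ((hw.mul_nat α).summable (s := x ^ α) (by positivity)).hasSum
  convert! ((h1.sub h2).mul_right (Real.exp (-γ * r))).add
    (h3.mul_right (if r ≤ 1 then r else 0)) using 1
  funext n
  have : ((Real.exp (-r) * x) ^ α) ^ n = Real.exp (-(α * n) * r) * (x ^ α) ^ n := by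
    rw [Real.mul_rpow (Real.exp_pos _).le hx.le, mul_pow, ← Real.exp_mul, ← Real.exp_nat_mul]
    congr 2
    ring
  rw [this, levyKernel]
  ring

theorem summable_powSeries_kernel_bound {α γ : ℝ} (hα : 0 < α) {w : ℕ → ℝ}
    (hw : EntireCoeff w) {s : ℝ} (hs : 0 ≤ s) :
    Summable fun n : ℕ => |w n| * s ^ n * (1 + (α * n) ^ 2 + α * n * γ) := by
  refine (((hw s hs).add (((hw.mul_nat α).mul_nat α) s hs)).add
    (((hw.mul_nat α) s hs).mul_right γ)).congr fun n => ?_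
  rw [abs_mul (α * n), abs_mul (α * n), abs_of_nonneg (show 0 ≤ α * n by positivity)]
  ring

theorem integrableOn_powSeries_kernel {ν : Measure ℝ}
    (hν : IntegrableOn (fun r : ℝ => min 1 (r ^ 2)) (Ioi 0) ν)
    {α γ : ℝ} (hα : 0 < α) (hγ : 0 ≤ γ) {w : ℕ → ℝ} (hw : EntireCoeff w)
    {x : ℝ} (hx : 0 < x) :
    IntegrableOn (fun r =>
      (powSeries α w (Real.exp (-r) * x) - powSeries α w x) * Real.exp (-γ * r)
        + powSeries α (fun n => α * n * w n) x * (if r ≤ 1 then r else 0)) (Ioi 0) ν := by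
  have hK := summable_powSeries_kernel_bound (γ := γ) hα hw (s := x ^ α) (by positivity)
  have hcont : Continuous fun r => powSeries α w (Real.exp (-r) * x) :=
    (contDiffOn_powSeries hα hw).continuousOn.comp_continuous (by fun_prop)
      fun r => mem_Ioi.2 (by positivity)
  refine (hν.const_mul (∑' n : ℕ, |w n| * (x ^ α) ^ n * (1 + (α * n) ^ 2 + α * n * γ))).mono'
    (Measurable.aestronglyMeasurable ?_) ?_
  · exact Measurable.add ((hcont.measurable.sub_const _).mul (by fun_prop))
      ((Measurable.ite measurableSet_Iic measurable_id measurable_const).const_mul _)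
  · filter_upwards [ae_restrict_mem measurableSet_Ioi] with r hr
    have hs := hasSum_levyKernel (α := α) (γ := γ) hw hx r
    rw [← hs.tsum_eq, ← tsum_mul_right]
    refine tsum_of_norm_bounded (hK.mul_right _).hasSum fun n => ?_
    rw [norm_mul, norm_mul, Real.norm_eq_abs, Real.norm_eq_abs, Real.norm_eq_abs,
      abs_of_nonneg (show 0 ≤ (x ^ α) ^ n by positivity), mul_assoc (|w n| * (x ^ α) ^ n)]
    gcongr
    exact abs_levyKernel_le hγ (by positivity) hr

theorem hasSum_integral_powSeries_kernel {ν : Measure ℝ}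
    (hν : IntegrableOn (fun r : ℝ => min 1 (r ^ 2)) (Ioi 0) ν)
    {α γ : ℝ} (hα : 0 < α) (hγ : 0 ≤ γ) {w : ℕ → ℝ} (hw : EntireCoeff w)
    {x : ℝ} (hx : 0 < x) :
    HasSum (fun n : ℕ => w n * (x ^ α) ^ n * ∫ r in Ioi (0 : ℝ), levyKernel γ (α * n) r ∂ν)
      (∫ r in Ioi (0 : ℝ),
        ((powSeries α w (Real.exp (-r) * x) - powSeries α w x) * Real.exp (-γ * r)
          + powSeries α (fun n => α * n * w n) x * (if r ≤ 1 then r else 0)) ∂ν) := by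
  have hK := summable_powSeries_kernel_bound (γ := γ) hα hw (s := x ^ α) (by positivity)
  have hint (n : ℕ) : IntegrableOn (levyKernel γ (α * n)) (Ioi 0) ν :=
    integrableOn_levyKernel hν hγ (by positivity)
  have h := hasSum_integral_of_summable_integral_norm
    (F := fun n r => w n * (x ^ α) ^ n * levyKernel γ (α * n) r)
    (fun n => (hint n).const_mul _) ?_
  · simp_rw [integral_const_mul, (hasSum_levyKernel hw hx _).tsum_eq] at h
    exact h
  · refine Summable.of_nonneg_of_le (fun n => integral_nonneg fun r => norm_nonneg _)
      (fun n => ?_) (hK.mul_right (∫ r in Ioi (0 : ℝ), min 1 (r ^ 2) ∂ν))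
    rw [← integral_const_mul]
    refine setIntegral_mono_on ((hint n).const_mul _).norm (hν.const_mul _) measurableSet_Ioi
      fun r hr => ?_
    rw [norm_mul, norm_mul, Real.norm_eq_abs, Real.norm_eq_abs, Real.norm_eq_abs,
      abs_of_nonneg (show 0 ≤ (x ^ α) ^ n by positivity), mul_assoc (|w n| * (x ^ α) ^ n)]
    gcongr
    exact abs_levyKernel_le hγ (by positivity) hr

theorem sq_mul_deriv_deriv_powSeries {α : ℝ} (hα : 0 < α) {w : ℕ → ℝ} (hw : EntireCoeff w)
    {x : ℝ} (hx : 0 < x) :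
    x ^ 2 * deriv (deriv (powSeries α w)) x =
      powSeries α (fun n => α * n * (α * n * w n)) x - powSeries α (fun n => α * n * w n) x := by
  have h1 : deriv (powSeries α w) =ᶠ[𝓝 x] fun y => powSeries α (fun n => α * n * w n) y / y := by
    filter_upwards [Ioi_mem_nhds hx] with y hy
    exact (hasDerivAt_powSeries hα hw hy).deriv
  rw [h1.deriv_eq,
    ((hasDerivAt_powSeries hα (hw.mul_nat α) hx).fun_div (hasDerivAt_id' x) hx.ne').deriv]
  field_simp

/-- The operator `L^{(γ)}` acts termwise, mapping `x^β` to `ψ_γ(β) x^{β-α}`. -/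
theorem hasSum_Lop_powSeries {σ b : ℝ} {ν : Measure ℝ}
    (hν : IntegrableOn (fun r : ℝ => min 1 (r ^ 2)) (Ioi 0) ν)
    {α γ : ℝ} (hα : 0 < α) (hγ : 0 ≤ γ) {w : ℕ → ℝ} (hw : EntireCoeff w)
    {x : ℝ} (hx : 0 < x) :
    HasSum (fun n : ℕ => x ^ (-α) *
        (w n * (x ^ α) ^ n * (psi σ b ν (α * n + γ) - psi σ b ν γ)))
      (Lop σ b γ α ν (powSeries α w) x) := by
  have hd := mul_deriv_powSeries hα hw hx
  have hs : 0 ≤ x ^ α := by positivity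
  have h1 := ((hw.mul_nat α).summable hs).hasSum
  have h2 := (((hw.mul_nat α).mul_nat α).summable hs).hasSum
  have h3 := hasSum_integral_powSeries_kernel hν hα hγ hw hx
  rw [Lop, hd, mul_assoc (σ / 2), sq_mul_deriv_deriv_powSeries hα hw hx,
    mul_assoc (σ * γ + b + σ / 2), hd]
  convert! ((((h2.sub h1).mul_left (σ / 2)).add
    (h1.mul_left (σ * γ + b + σ / 2))).add h3).mul_left (x ^ (-α)) using 1
  funext n
  rw [psi_add_sub hν hγ (by positivity)]
  ring

/-- Eigenfunction characterization (analytic core of Theorem 2.1): `f_q(x) = I_{α,ψ_γ}(q x^α)`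
is smooth on `(0,∞)`, the integral in `L^{(γ)} f_q` converges absolutely, and
`L^{(γ)} f_q = q f_q` on `(0,∞)`. -/
theorem Ifun_eigenfunction (σ b : ℝ) (ν : Measure ℝ)
    (hσ : 0 ≤ σ)
    (hν : ∫⁻ r in Ioi (0 : ℝ), ENNReal.ofReal (min 1 (r ^ 2)) ∂ν < ⊤)
    (hnd : 0 < σ ∨ ν (Ioi 0) ≠ 0 ∨ b ≠ 0)
    (hns : 0 < σ ∨ ¬ IntegrableOn (fun r => r) (Ioc 0 1) ν ∨
      0 < b - ∫ r in Ioc (0 : ℝ) 1, r ∂ν)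
    (γ α : ℝ) (hγ : 0 ≤ γ) (hα : 0 < α)
    (hpos : ∀ k : ℕ, 1 ≤ k → 0 < psi σ b ν (α * k + γ) - psi σ b ν γ)
    (q : ℝ) (hq : 0 ≤ q) :
    ContDiffOn ℝ (⊤ : ℕ∞)
      (fun x : ℝ => Iser (fun u => psi σ b ν (u + γ) - psi σ b ν γ) α (q * x ^ α))
      (Ioi 0) ∧
    ∀ x : ℝ, 0 < x →
      IntegrableOn
        (fun r =>
          (Iser (fun u => psi σ b ν (u + γ) - psi σ b ν γ) α (q * (Real.exp (-r) * x) ^ α)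
            - Iser (fun u => psi σ b ν (u + γ) - psi σ b ν γ) α (q * x ^ α))
              * Real.exp (-γ * r)
          + x * deriv (fun y : ℝ =>
              Iser (fun u => psi σ b ν (u + γ) - psi σ b ν γ) α (q * y ^ α)) x
            * (if r ≤ 1 then r else 0)) (Ioi 0) ν ∧
      Lop σ b γ α ν
        (fun y : ℝ => Iser (fun u => psi σ b ν (u + γ) - psi σ b ν γ) α (q * y ^ α)) x =
      q * Iser (fun u => psi σ b ν (u + γ) - psi σ b ν γ) α (q * x ^ α) := by
  have hν' := integrableOn_min_one_sq hν
  set ψ : ℝ → ℝ := fun u => psi σ b ν (u + γ) - psi σ b ν γ with hψ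
  have hc : 0 < ψ α := by simpa [hψ] using hpos 1 le_rfl
  have hposψ (n : ℕ) : 0 < ψ (α * (n + 1)) := by simpa [hψ] using hpos (n + 1) (by simp)
  have hlow (k : ℕ) : (k + 1) * ψ α ≤ ψ (α * (k + 1)) := by
    simpa [hψ] using mul_psi_le (b := b) hσ hν' hγ hα.le (k + 1)
  set w : ℕ → ℝ := fun n => coeffA ψ α n * q ^ n with hwdef
  have hw : EntireCoeff w := entireCoeff_coeffA hc hlow q
  have hI (x : ℝ) : Iser ψ α (q * x ^ α) = powSeries α w x :=
    tsum_congr fun n => by rw [hwdef, mul_pow, mul_assoc]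
  simp only [hI]
  refine ⟨contDiffOn_powSeries hα hw, fun x hx => ⟨?_, ?_⟩⟩
  · rw [mul_deriv_powSeries hα hw hx]
    exact integrableOn_powSeries_kernel hν' hα hγ hw hx
  · have h := hasSum_Lop_powSeries (σ := σ) (b := b) hν' hα hγ hw hx
    rw [← hasSum_nat_add_iff' 1] at h
    have h' := ((hw.summable (s := x ^ α) (by positivity)).hasSum).mul_left q
    simp only [Finset.range_one, Finset.sum_singleton, Nat.cast_zero, mul_zero, zero_add,
      sub_self, sub_zero] at h
    refine h.unique ?_
    convert! h' using 1
    funext n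
    have hrec := coeffA_succ_mul (hposψ n).ne'
    have hx1 : x ^ (-α) * x ^ α = 1 := by rw [← Real.rpow_add hx, neg_add_cancel, Real.rpow_zero]
    have hψn : psi σ b ν (α * ((n + 1 : ℕ) : ℝ) + γ) - psi σ b ν γ = ψ (α * (n + 1)) := by
      rw [hψ, Nat.cast_succ]
    rw [hψn]
    simp only [hwdef, ← hrec, pow_succ]
    linear_combination (coeffA ψ α (n + 1) * (q ^ n * q) * (x ^ α) ^ n * ψ (α * (n + 1))) * hx1
end

section
/- (Bessel special case of Theorem 2.2; Section 4.1.) Let 0 < δ < 1, let ψ(u) = u²/2 − δ·u (so σ = 1, b = −δ, ν = 0, m = −δ < 0 and θ = 2δ), and take α = 2. Then: (i) I_{2,ψ}(x) = Γ(1−δ)·(x/2)^{δ/2}·I_{−δ}(√(2x)) and I_{2,ψ_θ}(x) = Γ(1+δ)·(x/2)^{−δ/2}·I_{δ}(√(2x)) for x > 0; (ii) lim_{x→∞} I_{2,ψ}(x²) / (x^{2δ} · I_{2,ψ_θ}(x²)) = 2^{−δ}·Γ(1−δ)/Γ(1+δ), i.e. C_θ = 2^{−δ}Γ(1−δ)/Γ(1+δ);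 and (iii) consequently N(x) := I_{2,ψ}(x) − C_θ·x^{δ}·I_{2,ψ_θ}(x) = Γ(1−δ)·(x/2)^{δ/2}·( I_{−δ}(√(2x)) − I_{δ}(√(2x)) ) for all x > 0. -/
open MeasureTheory Real Set Filter Topology

/-- The modified Bessel function of the first kind of index `v`:
`I_v(x) = Σ_{n≥0} (x/2)^{v+2n} / (n! Γ(v+n+1))`. -/
noncomputable def besselI (v x : ℝ) : ℝ :=
  ∑' n : ℕ, (x / 2) ^ (v + 2 * (n : ℝ)) / ((n.factorial : ℝ) * Real.Gamma (v + n + 1))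

/-- The entire function `∑ yⁿ / (n! Γ(v + n + 1))` underlying the Bessel function `I_v`. -/
noncomputable def besselSeries (v y : ℝ) : ℝ :=
  ∑' n : ℕ, y ^ n / ((n.factorial : ℝ) * Real.Gamma (v + n + 1))

lemma besselI_sqrt_two_mul (v : ℝ) {x : ℝ} (hx : 0 < x) :
    besselI v (√(2 * x)) = (x / 2) ^ (v / 2) * besselSeries v (x / 2) := by
  have hs : √(2 * x) / 2 = (x / 2) ^ (1 / 2 : ℝ) := by
    rw [← Real.sqrt_eq_rpow, show 2 * x = 2 ^ 2 * (x / 2) by ring,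
      Real.sqrt_mul (by positivity), Real.sqrt_sq (by norm_num)]
    ring
  rw [besselI, besselSeries, ← tsum_mul_left]
  congr 1 with n
  rw [hs, ← Real.rpow_mul (by positivity), ← Real.rpow_natCast (x / 2) n, ← mul_div_assoc,
    ← Real.rpow_add (by positivity)]
  ring_nf

lemma prod_range_eq_factorial_mul_Gamma {v : ℝ} (hv : -1 < v) (n : ℕ) :
    (∏ k ∈ Finset.range n, 2 * ((k : ℝ) + 1) * (k + 1 + v)) * Real.Gamma (1 + v) =
      2 ^ n * (n.factorial * Real.Gamma (v + n + 1)) := by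
  induction n with
  | zero => simp [add_comm]
  | succ n ih =>
    have hn : v + n + 1 ≠ 0 := by
      have : (0 : ℝ) ≤ n := n.cast_nonneg
      linarith
    rw [Finset.prod_range_succ, mul_right_comm, ih, Nat.factorial_succ]
    push_cast
    rw [show v + ((n : ℝ) + 1) + 1 = (v + n + 1) + 1 by ring, Real.Gamma_add_one hn]
    ring

lemma Iser_two_eq {φ : ℝ → ℝ} {v : ℝ} (hv : -1 < v) (hφ : ∀ u, φ u = u ^ 2 / 2 + v * u) (x : ℝ) :
    Iser φ 2 x = Real.Gamma (1 + v) * besselSeries v (x / 2) := by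
  rw [Iser, besselSeries, ← tsum_mul_left]
  congr 1 with n
  have hG : 0 < Real.Gamma (1 + v) := Real.Gamma_pos_of_pos (by linarith)
  have hn : 0 < Real.Gamma (v + n + 1) :=
    Real.Gamma_pos_of_pos (by have : (0 : ℝ) ≤ n := n.cast_nonneg
                              linarith)
  have hprod := prod_range_eq_factorial_mul_Gamma hv n
  have hc : ∏ k ∈ Finset.range n, φ (2 * (k + 1)) =
      ∏ k ∈ Finset.range n, 2 * ((k : ℝ) + 1) * (k + 1 + v) :=
    Finset.prod_congr rfl fun k _ => by rw [hφ]; ring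
  rw [coeffA, hc, eq_div_of_mul_eq hG.ne' hprod, div_pow]
  field_simp

/-- The general term of `besselSeries`. -/
noncomputable def besselTerm (v y : ℝ) (n : ℕ) : ℝ :=
  y ^ n / ((n.factorial : ℝ) * Real.Gamma (v + n + 1))

lemma besselTerm_pos {v y : ℝ} (hv : -1 < v) (hy : 0 < y) (n : ℕ) : 0 < besselTerm v y n := by
  have : 0 < Real.Gamma (v + n + 1) :=
    Real.Gamma_pos_of_pos (by have : (0 : ℝ) ≤ n := n.cast_nonneg
                              linarith)
  unfold besselTerm
  positivity

lemma besselTerm_succ {v : ℝ} (hv : -1 < v) (y : ℝ) (n : ℕ) :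
    ((n : ℝ) + 1) * (n + 1 + v) * besselTerm v y (n + 1) = y * besselTerm v y n := by
  have hn : 0 < v + n + 1 := by
    have : (0 : ℝ) ≤ n := n.cast_nonneg
    linarith
  have hG : 0 < Real.Gamma (v + n + 1) := Real.Gamma_pos_of_pos hn
  unfold besselTerm
  rw [Nat.factorial_succ]
  push_cast
  rw [show v + ((n : ℝ) + 1) + 1 = (v + n + 1) + 1 by ring, Real.Gamma_add_one hn.ne']
  rw [show (n : ℝ) + 1 + v = v + n + 1 by ring]
  field_simp
  ring

lemma hasSum_besselTerm {v y : ℝ} (hv : -1 < v) (hy : 0 < y) :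
    HasSum (besselTerm v y) (besselSeries v y) := by
  refine Summable.hasSum (summable_of_ratio_test_tendsto_lt_one zero_lt_one
    (Eventually.of_forall fun n => (besselTerm_pos hv hy n).ne') ?_)
  have hr : ∀ n : ℕ, ‖besselTerm v y (n + 1)‖ / ‖besselTerm v y n‖ =
      y * ((((n : ℝ) + 1))⁻¹ * ((n : ℝ) + (1 + v))⁻¹) := fun n => by
    have hn : 0 < (n : ℝ) + 1 + v := by
      have : (0 : ℝ) ≤ n := n.cast_nonneg
      linarith
    have h0 := besselTerm_pos hv hy n
    rw [Real.norm_of_nonneg (besselTerm_pos hv hy _).le, Real.norm_of_nonneg h0.le,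
      ← add_assoc]
    have := besselTerm_succ hv y n
    field_simp
    linarith
  simp_rw [hr]
  have h (c : ℝ) : Tendsto (fun n : ℕ => ((n : ℝ) + c)⁻¹) atTop (𝓝 0) :=
    tendsto_inv_atTop_zero.comp (tendsto_atTop_add_const_right _ _ tendsto_natCast_atTop_atTop)
  simpa using ((h 1).mul (h (1 + v))).const_mul y

lemma besselSeries_pos {v y : ℝ} (hv : -1 < v) (hy : 0 < y) : 0 < besselSeries v y :=
  (hasSum_besselTerm hv hy).summable.tsum_pos (fun n => (besselTerm_pos hv hy n).le) 0
    (besselTerm_pos hv hy 0)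

lemma hasSum_mul_besselTerm {v y : ℝ} (hv : -1 < v) (hy : 0 < y) :
    HasSum (fun n : ℕ => (n : ℝ) * (n + v) * besselTerm v y n) (y * besselSeries v y) := by
  rw [← hasSum_nat_add_iff' 1]
  simpa [besselTerm_succ hv y] using (hasSum_besselTerm hv hy).mul_left y

lemma hasSum_mul_mul_besselTerm {v y : ℝ} (hv : -1 < v) (hy : 0 < y) :
    HasSum (fun n : ℕ => (n : ℝ) * (n + v) * ((n - 1) * (n - 1 + v)) * besselTerm v y n)
      (y ^ 2 * besselSeries v y) := by
  rw [← hasSum_nat_add_iff' 1]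
  have e (n : ℕ) : ((n + 1 : ℕ) : ℝ) * ((n + 1 : ℕ) + v) *
      (((n + 1 : ℕ) - 1) * ((n + 1 : ℕ) - 1 + v)) * besselTerm v y (n + 1) =
      y * (n * (n + v) * besselTerm v y n) := by
    push_cast
    linear_combination ((n : ℝ) * (n + v)) * besselTerm_succ hv y n
  simp only [e, Finset.sum_range_one, Nat.cast_zero, zero_mul, sub_zero, pow_two, mul_assoc y y]
  exact (hasSum_mul_besselTerm hv hy).mul_left y

/-- Wendel-type inequality, from the log-convexity of `Γ`. -/
lemma Gamma_add_two_mul_le {z a : ℝ} (hz : 0 < z) (ha0 : 0 < a) (ha1 : a < 1) :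
    Real.Gamma (z + 2 * a) ≤ Real.Gamma z * (z * (z + 1)) ^ a := by
  have hG : 0 < Real.Gamma z := Real.Gamma_pos_of_pos hz
  have h := Real.Gamma_mul_add_mul_le_rpow_Gamma_mul_rpow_Gamma hz (show 0 < z + 1 + 1 by linarith)
    (sub_pos.2 ha1) ha0 (by ring)
  rw [Real.Gamma_add_one (by linarith), Real.Gamma_add_one hz.ne',
    show (z + 1) * (z * Real.Gamma z) = Real.Gamma z * (z * (z + 1)) by ring,
    Real.mul_rpow hG.le (by positivity), ← mul_assoc, ← Real.rpow_add hG] at h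
  convert h using 2
  · ring
  · simp

lemma le_Gamma_add_two_mul {z a : ℝ} (hz : 0 < z) (ha0 : 0 < a) (ha1 : a < 1) :
    Real.Gamma (z + 2 * (1 - a)) * (z * (z + 1)) ^ a ≤ Real.Gamma (z + 2) := by
  have h := Gamma_add_two_mul_le hz (sub_pos.2 ha1) (by linarith : 1 - a < 1)
  have hp : 0 < z * (z + 1) := by positivity
  calc _ ≤ Real.Gamma z * (z * (z + 1)) ^ (1 - a) * (z * (z + 1)) ^ a := by gcongr
    _ = Real.Gamma z * (z * (z + 1)) := by
      rw [mul_assoc, ← Real.rpow_add hp]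
      simp
    _ = _ := by
      rw [show z + 2 = z + 1 + 1 by ring, Real.Gamma_add_one (by linarith),
        Real.Gamma_add_one hz.ne']
      ring

lemma rpow_le_one_add_abs {t a : ℝ} (ht : 0 < t) (ha0 : 0 < a) (ha1 : a < 1) :
    t ^ a ≤ 1 + |t - 1| := by
  rcases le_total t 1 with h | h
  · linarith [Real.rpow_le_one ht.le h ha0.le, abs_nonneg (t - 1)]
  · linarith [Real.rpow_le_self_of_one_le h ha1.le, le_abs_self (t - 1)]

lemma one_sub_abs_le_rpow {t a : ℝ} (ht : 0 < t) (ha0 : 0 < a) (ha1 : a < 1) :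
    1 - |t - 1| ≤ t ^ a := by
  rcases le_total t 1 with h | h
  · linarith [Real.self_le_rpow_of_le_one ht.le h ha1.le, neg_abs_le (t - 1)]
  · linarith [Real.one_le_rpow h ha0.le, abs_nonneg (t - 1)]

lemma abs_Gamma_div_Gamma_sub_rpow_le {δ y : ℝ} (hδ0 : 0 < δ) (hδ1 : δ < 1) (hy : 0 < y) (n : ℕ) :
    |Real.Gamma (δ + n + 1) / Real.Gamma (-δ + n + 1) - y ^ δ| ≤
      y ^ δ * (|n * (n + δ) / y - 1| + (3 * n + 2) / y) := by
  have hn0 : (0 : ℝ) ≤ n := n.cast_nonneg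
  have hG : 0 < Real.Gamma (-δ + n + 1) := Real.Gamma_pos_of_pos (by linarith)
  have hG' : 0 < Real.Gamma (δ + n + 1) := Real.Gamma_pos_of_pos (by linarith)
  have hyδ : 0 < y ^ δ := Real.rpow_pos_of_pos hy δ
  have key : ∀ p : ℝ, |p - n * (n + δ)| ≤ 3 * n + 2 →
      |p / y - 1| ≤ |n * (n + δ) / y - 1| + (3 * n + 2) / y := fun p hp => by
    calc |p / y - 1| = |(n * (n + δ) / y - 1) + (p - n * (n + δ)) / y| := by
          congr 1
          ring
      _ ≤ |n * (n + δ) / y - 1| + |(p - n * (n + δ)) / y| := abs_add_le _ _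
      _ ≤ _ := by
        rw [abs_div _ y, abs_of_pos hy]
        gcongr
  rw [abs_le]
  constructor
  · rcases Nat.eq_zero_or_pos n with rfl | hn
    · have : 0 < y ^ δ * (2 / y) := by positivity
      have : 0 < Real.Gamma (δ + (0 : ℕ) + 1) / Real.Gamma (-δ + (0 : ℕ) + 1) := div_pos hG' hG
      simp at *
      linarith
    · have hn1 : (1 : ℝ) ≤ n := by exact_mod_cast hn
      have hz : 0 < (n : ℝ) - 1 + δ := by linarith
      have hp : 0 < ((n : ℝ) - 1 + δ) * (n - 1 + δ + 1) := by positivity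
      have h := le_Gamma_add_two_mul hz hδ0 hδ1
      rw [show (n : ℝ) - 1 + δ + 2 * (1 - δ) = -δ + n + 1 by ring,
        show (n : ℝ) - 1 + δ + 2 = δ + n + 1 by ring, mul_comm, ← le_div_iff₀ hG] at h
      have h1 := one_sub_abs_le_rpow (div_pos hp hy) hδ0 hδ1
      rw [Real.div_rpow hp.le hy.le, le_div_iff₀ hyδ] at h1
      have h2 := key (((n : ℝ) - 1 + δ) * (n - 1 + δ + 1)) (by rw [abs_le]; constructor <;> nlinarith)
      nlinarith
  · have hz : 0 < (n : ℝ) + 1 - δ := by linarith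
    have hp : 0 < ((n : ℝ) + 1 - δ) * (n + 1 - δ + 1) := by positivity
    have h := Gamma_add_two_mul_le hz hδ0 hδ1
    rw [show (n : ℝ) + 1 - δ + 2 * δ = δ + n + 1 by ring,
      show Real.Gamma ((n : ℝ) + 1 - δ) = Real.Gamma (-δ + n + 1) by ring_nf, mul_comm,
      ← div_le_iff₀ hG] at h
    have h1 := rpow_le_one_add_abs (div_pos hp hy) hδ0 hδ1
    rw [Real.div_rpow hp.le hy.le, div_le_iff₀ hyδ] at h1
    have h2 := key (((n : ℝ) + 1 - δ) * (n + 1 - δ + 1)) (by rw [abs_le]; constructor <;> nlinarith)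
    nlinarith

/-- The deviation of `n (n + δ)` from `t⁴`, bounded by factorial moments, whose sums against
`besselTerm δ (t ^ 4)` are explicit. -/
lemma abs_sub_one_add_le_moments {δ t : ℝ} (hδ0 : 0 < δ) (hδ1 : δ < 1) (ht : 0 < t) (n : ℕ) :
    |n * (n + δ) / t ^ 4 - 1| + (3 * n + 2) / t ^ 4 ≤
      (1 / t + t + 3 / (2 * t ^ 2) + 2 / t ^ 4) +
      (t * ((t ^ 2 + 2) / t ^ 8 - 2 / t ^ 4) + 3 / (2 * t ^ 6)) * (n * (n + δ)) +
      t * (1 + 1 / t ^ 2) / t ^ 8 * (n * (n + δ) * ((n - 1) * (n - 1 + δ))) := by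
  have hn0 : (0 : ℝ) ≤ n := n.cast_nonneg
  set q : ℝ := n * (n + δ) with hq
  set q' : ℝ := ((n : ℝ) - 1) * (n - 1 + δ) with hq'
  have hq0 : 0 ≤ q := by positivity
  have h1 : |q / t ^ 4 - 1| ≤ 1 / t + t * (q / t ^ 4 - 1) ^ 2 := by
    rw [← sq_abs (q / t ^ 4 - 1)]
    set X := |q / t ^ 4 - 1|
    have : 1 / t + t * X ^ 2 - X = (1 / t) * ((t * X - 1 / 2) ^ 2 + 3 / 4) := by
      field_simp
      ring
    have : 0 ≤ (1 / t) * ((t * X - 1 / 2) ^ 2 + 3 / 4) := by positivity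
    linarith
  have h2 : q ^ 2 ≤ q * q' * (1 + 1 / t ^ 2) + (t ^ 2 + 2) * q := by
    rcases Nat.eq_zero_or_pos n with hn | hn
    · simp [hq, hn]
    have hm : (0 : ℝ) ≤ n - 1 := by
      have : (1 : ℝ) ≤ n := by exact_mod_cast hn
      linarith
    have h3 : q ≤ q' * (1 + 1 / t ^ 2) + (t ^ 2 + 2) := by
      have h4 : 2 * ((n : ℝ) - 1) ≤ ((n : ℝ) - 1) ^ 2 * (1 / t ^ 2) + t ^ 2 := by
        have : ((n : ℝ) - 1) ^ 2 * (1 / t ^ 2) + t ^ 2 - 2 * ((n : ℝ) - 1) =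
            (((n : ℝ) - 1) / t - t) ^ 2 := by
          field_simp
          ring
        linarith [sq_nonneg (((n : ℝ) - 1) / t - t)]
      have h5 : 0 ≤ ((n : ℝ) - 1) * δ * (1 / t ^ 2) := by positivity
      rw [hq, hq']
      linarith
    nlinarith [mul_le_mul_of_nonneg_left h3 hq0]
  have h3 : 3 * (n : ℝ) ≤ 3 / (2 * t ^ 2) * q + 3 / 2 * t ^ 2 := by
    have e : 3 / (2 * t ^ 2) * (n : ℝ) ^ 2 + 3 / 2 * t ^ 2 - 3 * n =
        3 / 2 * ((n : ℝ) / t - t) ^ 2 := by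
      field_simp
      ring
    have : 3 / (2 * t ^ 2) * (n : ℝ) ^ 2 ≤ 3 / (2 * t ^ 2) * q := by
      gcongr
      nlinarith
    linarith [sq_nonneg ((n : ℝ) / t - t)]
  calc |q / t ^ 4 - 1| + (3 * n + 2) / t ^ 4
      ≤ (1 / t + t * (q / t ^ 4 - 1) ^ 2) +
          (3 / (2 * t ^ 2) * q + 3 / 2 * t ^ 2 + 2) / t ^ 4 := by gcongr
    _ = 1 / t + t + 3 / (2 * t ^ 2) + 2 / t ^ 4 - 2 * t / t ^ 4 * q + 3 / (2 * t ^ 6) * q +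
          t / t ^ 8 * q ^ 2 := by
      field_simp
      ring
    _ ≤ 1 / t + t + 3 / (2 * t ^ 2) + 2 / t ^ 4 - 2 * t / t ^ 4 * q + 3 / (2 * t ^ 6) * q +
          t / t ^ 8 * (q * q' * (1 + 1 / t ^ 2) + (t ^ 2 + 2) * q) := by gcongr
    _ = _ := by ring

lemma abs_besselSeries_neg_sub_le {δ t : ℝ} (hδ0 : 0 < δ) (hδ1 : δ < 1) (ht : 0 < t) :
    |besselSeries (-δ) (t ^ 4) - (t ^ 4) ^ δ * besselSeries δ (t ^ 4)| ≤
      (t ^ 4) ^ δ * besselSeries δ (t ^ 4) * (3 / t + 3 / t ^ 2 + 2 / t ^ 3 + 2 / t ^ 4) := by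
  have hy : 0 < t ^ 4 := by positivity
  have hδ : -1 < δ := by linarith
  have hδ' : -1 < -δ := by linarith
  have hdiff := (hasSum_besselTerm hδ' hy).sub ((hasSum_besselTerm hδ hy).mul_left ((t ^ 4) ^ δ))
  have hbound := ((((hasSum_besselTerm hδ hy).mul_left
    (1 / t + t + 3 / (2 * t ^ 2) + 2 / t ^ 4)).add
    ((hasSum_mul_besselTerm hδ hy).mul_left
      (t * ((t ^ 2 + 2) / t ^ 8 - 2 / t ^ 4) + 3 / (2 * t ^ 6)))).add
    ((hasSum_mul_mul_besselTerm hδ hy).mul_left (t * (1 + 1 / t ^ 2) / t ^ 8))).mul_left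
    ((t ^ 4) ^ δ)
  rw [← hdiff.tsum_eq, ← Real.norm_eq_abs]
  refine (tsum_of_norm_bounded hbound fun n => ?_).trans (le_of_eq ?_)
  · have hw := besselTerm_pos hδ hy n
    have hn0 : (0 : ℝ) ≤ n := n.cast_nonneg
    have hG : 0 < Real.Gamma (-δ + n + 1) := Real.Gamma_pos_of_pos (by linarith)
    have hG' : 0 < Real.Gamma (δ + n + 1) := Real.Gamma_pos_of_pos (by linarith)
    have e : besselTerm (-δ) (t ^ 4) n = besselTerm δ (t ^ 4) n *
        (Real.Gamma (δ + n + 1) / Real.Gamma (-δ + n + 1)) := by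
      unfold besselTerm
      field_simp
    rw [e, mul_comm ((t ^ 4) ^ δ), ← mul_sub, Real.norm_eq_abs, abs_mul, abs_of_pos hw]
    have h1 := abs_Gamma_div_Gamma_sub_rpow_le hδ0 hδ1 hy n
    have h2 := abs_sub_one_add_le_moments hδ0 hδ1 ht n
    calc _ ≤ besselTerm δ (t ^ 4) n * ((t ^ 4) ^ δ * _) :=
          mul_le_mul_of_nonneg_left
            (h1.trans (mul_le_mul_of_nonneg_left h2 (by positivity))) hw.le
      _ = _ := by ring
  · field_simp
    ring

lemma tendsto_besselSeries_ratio {δ : ℝ} (hδ0 : 0 < δ) (hδ1 : δ < 1) :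
    Tendsto (fun t : ℝ => besselSeries (-δ) (t ^ 4) / ((t ^ 4) ^ δ * besselSeries δ (t ^ 4)))
      atTop (𝓝 1) := by
  rw [tendsto_iff_norm_sub_tendsto_zero]
  have h (k : ℕ) (hk : k ≠ 0) (c : ℝ) : Tendsto (fun t : ℝ => c / t ^ k) atTop (𝓝 0) :=
    tendsto_const_nhds.div_atTop (tendsto_pow_atTop hk)
  have hlim : Tendsto (fun t : ℝ => 3 / t + 3 / t ^ 2 + 2 / t ^ 3 + 2 / t ^ 4) atTop (𝓝 0) := by
    simpa using (((h 1 (by simp) 3).add (h 2 (by simp) 3)).add (h 3 (by simp) 2)).add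
      (h 4 (by simp) 2)
  refine squeeze_zero' (Eventually.of_forall fun t => norm_nonneg _) ?_ hlim
  filter_upwards [eventually_gt_atTop 0] with t ht
  have hS := besselSeries_pos (v := δ) (by linarith) (show 0 < t ^ 4 by positivity)
  have hD : 0 < (t ^ 4) ^ δ * besselSeries δ (t ^ 4) := by positivity
  rw [div_sub_one hD.ne', Real.norm_eq_abs, abs_div, abs_of_pos hD, div_le_iff₀ hD,
    mul_comm (_ + _)]
  exact abs_besselSeries_neg_sub_le hδ0 hδ1 ht

/-- Bessel special case of Theorem 2.2 (Section 4.1): for `ψ(u) = u²/2 - δu`, `α = 2`,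
`θ = 2δ`, the series `I_{2,ψ}` and `I_{2,ψ_θ}` are modified Bessel functions, the asymptotic
constant is `C_θ = 2^{-δ} Γ(1-δ)/Γ(1+δ)`, and `N = I_{2,ψ} - C_θ x^δ I_{2,ψ_θ}` is a
MacDonald-type combination. -/
theorem bessel_special_case (δ : ℝ) (hδ0 : 0 < δ) (hδ1 : δ < 1) :
    (∀ x : ℝ, 0 < x →
      Iser (fun u => u ^ 2 / 2 - δ * u) 2 x =
        Real.Gamma (1 - δ) * (x / 2) ^ (δ / 2) * besselI (-δ) (Real.sqrt (2 * x)) ∧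
      Iser (fun u => (u + 2 * δ) ^ 2 / 2 - δ * (u + 2 * δ) -
          ((2 * δ) ^ 2 / 2 - δ * (2 * δ))) 2 x =
        Real.Gamma (1 + δ) * (x / 2) ^ (-(δ / 2)) * besselI δ (Real.sqrt (2 * x))) ∧
    Tendsto (fun x : ℝ =>
        Iser (fun u => u ^ 2 / 2 - δ * u) 2 (x ^ 2) /
          (x ^ (2 * δ) *
            Iser (fun u => (u + 2 * δ) ^ 2 / 2 - δ * (u + 2 * δ) -
              ((2 * δ) ^ 2 / 2 - δ * (2 * δ))) 2 (x ^ 2)))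
      atTop (𝓝 ((2 : ℝ) ^ (-δ) * Real.Gamma (1 - δ) / Real.Gamma (1 + δ))) ∧
    ∀ x : ℝ, 0 < x →
      Iser (fun u => u ^ 2 / 2 - δ * u) 2 x -
          (2 : ℝ) ^ (-δ) * Real.Gamma (1 - δ) / Real.Gamma (1 + δ) * x ^ δ *
            Iser (fun u => (u + 2 * δ) ^ 2 / 2 - δ * (u + 2 * δ) -
              ((2 * δ) ^ 2 / 2 - δ * (2 * δ))) 2 x =
        Real.Gamma (1 - δ) * (x / 2) ^ (δ / 2) *
          (besselI (-δ) (Real.sqrt (2 * x)) - besselI δ (Real.sqrt (2 * x))) := by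
  have hψ : ∀ x, Iser (fun u => u ^ 2 / 2 - δ * u) 2 x =
      Real.Gamma (1 - δ) * besselSeries (-δ) (x / 2) := fun x =>
    Iser_two_eq (v := -δ) (by linarith) (fun u => by ring) x
  have hθ : ∀ x, Iser (fun u => (u + 2 * δ) ^ 2 / 2 - δ * (u + 2 * δ) -
      ((2 * δ) ^ 2 / 2 - δ * (2 * δ))) 2 x = Real.Gamma (1 + δ) * besselSeries δ (x / 2) := fun x =>
    Iser_two_eq (v := δ) (by linarith) (fun u => by ring) x
  have hG : 0 < Real.Gamma (1 + δ) := Real.Gamma_pos_of_pos (by linarith)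
  simp only [hψ, hθ]
  refine ⟨fun x hx => ?_, ?_, fun x hx => ?_⟩
  · rw [besselI_sqrt_two_mul _ hx, besselI_sqrt_two_mul _ hx]
    have hp : 0 < (x / 2) ^ (δ / 2) := by positivity
    rw [neg_div, Real.rpow_neg (by positivity)]
    constructor <;> field_simp
  · have hs : Tendsto (fun x : ℝ => √(x / √2)) atTop atTop :=
      Real.tendsto_sqrt_atTop.comp (tendsto_id.atTop_div_const (by positivity))
    have h := ((tendsto_besselSeries_ratio hδ0 hδ1).comp hs).const_mul
      ((2 : ℝ) ^ (-δ) * Real.Gamma (1 - δ) / Real.Gamma (1 + δ))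
    rw [mul_one] at h
    refine h.congr' ?_
    filter_upwards [eventually_gt_atTop 0] with x hx
    have ht : √(x / √2) ^ 4 = x ^ 2 / 2 := by
      rw [show √(x / √2) ^ 4 = (√(x / √2) ^ 2) ^ 2 by ring, Real.sq_sqrt (by positivity),
        div_pow, Real.sq_sqrt (by norm_num)]
    have hS := besselSeries_pos (v := δ) (by linarith) (show 0 < x ^ 2 / 2 by positivity)
    have hx2 : x ^ (2 * δ) = (x ^ 2) ^ δ := by
      rw [Real.rpow_mul hx.le, Real.rpow_two]
    simp only [Function.comp_apply, ht]
    rw [hx2, Real.div_rpow (by positivity) (by norm_num), Real.rpow_neg (by norm_num)]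
    field_simp
  · rw [besselI_sqrt_two_mul _ hx, besselI_sqrt_two_mul _ hx]
    have hp : 0 < (x / 2) ^ (δ / 2) := by positivity
    have hx2 : (2 : ℝ) ^ (-δ) * x ^ δ = (x / 2) ^ (δ / 2) * (x / 2) ^ (δ / 2) := by
      rw [← Real.rpow_add (by positivity), add_halves, Real.div_rpow hx.le (by norm_num),
        Real.rpow_neg (by norm_num)]
      ring
    have e : (2 : ℝ) ^ (-δ) * Real.Gamma (1 - δ) / Real.Gamma (1 + δ) * x ^ δ *
        (Real.Gamma (1 + δ) * besselSeries δ (x / 2)) =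
        ((2 : ℝ) ^ (-δ) * x ^ δ) * (Real.Gamma (1 - δ) * besselSeries δ (x / 2)) := by
      field_simp
    rw [e, hx2, neg_div, Real.rpow_neg (by positivity)]
    field_simp
end
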